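/- arXiv:1705.08551 — 6 statements merged into one kernel-verified Lean document; each statement's English description precedes it below -/
import Mathlib

section
/- Let f : ℝ^d → ℝ^d be continuous with f(0) = 0, let v : ℝ^d → ℝ be continuous with v(0) = 0, let c > 0, and let K = {x ∈ ℝ^d | v(x) ≤ c}. Assume K is compact, v(x) > 0 for every x ∈ K \ {0}, and v(f(x)) < v(x) for every x ∈ K \ {0}. Then K is a region of attraction for the discrete-time system x_{t+1} = f(x_t): for every x₀ ∈ K the trajectory defined by x_{t+1} = f(x_t) satisfies x_t ∈ K for all t ∈ ℕ, and x_t → 0 as t → ∞. -/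
open Filter Topology

noncomputable section

abbrev Vec (n : ℕ) := PiLp 1 (fun _ : Fin n => ℝ)

/-- a compact sublevel set of a Lyapunov function on which the
one-step decrease condition holds is a region of attraction for the
discrete-time system `x_{t+1} = f x_t`. -/
theorem compact_sublevel_is_region_of_attraction
    (d : ℕ) (f : Vec d → Vec d) (v : Vec d → ℝ) (c : ℝ)
    (hf : Continuous f) (hf0 : f 0 = 0)
    (hv : Continuous v) (hv0 : v 0 = 0) (hc : 0 < c)
    (K : Set (Vec d)) (hK : K = {x : Vec d | v x ≤ c})
    (hKcomp : IsCompact K)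
    (hvpos : ∀ x ∈ K \ {0}, 0 < v x)
    (hdec : ∀ x ∈ K \ {0}, v (f x) < v x) :
    ∀ x : ℕ → Vec d, x 0 ∈ K → (∀ t : ℕ, x (t + 1) = f (x t)) →
      (∀ t : ℕ, x t ∈ K) ∧ Tendsto x atTop (𝓝 0) := by
  intro x hx0 hx
  have hle : ∀ y ∈ K, v (f y) ≤ v y := by
    intro y hy
    by_cases h : y = 0
    · rw [h, hf0]
    · exact (hdec y ⟨hy, h⟩).le
  have hnn : ∀ y ∈ K, 0 ≤ v y := by
    intro y hy
    by_cases h : y = 0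
    · rw [h, hv0]
    · exact (hvpos y ⟨hy, h⟩).le
  have hmem : ∀ t, x t ∈ K := by
    intro t
    induction t with
    | zero => exact hx0
    | succ t ih =>
      have h1 := hle _ ih
      rw [hx]
      rw [hK] at ih ⊢
      exact h1.trans ih
  refine ⟨hmem, ?_⟩
  have hanti : Antitone (fun t => v (x t)) := by
    refine antitone_nat_of_succ_le fun t => ?_
    rw [hx]
    exact hle _ (hmem t)
  have hbdd : BddBelow (Set.range (fun t => v (x t))) := by
    refine ⟨0, ?_⟩
    rintro _ ⟨t, rfl⟩
    exact hnn _ (hmem t)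
  have hlim := tendsto_atTop_ciInf hanti hbdd
  have hlim2 : Tendsto (fun t => v (f (x t))) atTop (𝓝 (⨅ t, v (x t))) := by
    have h := hlim.comp (tendsto_add_atTop_nat 1)
    refine h.congr fun t => ?_
    simp only [Function.comp, hx]
  have key : ∀ (w : Vec d → ℝ) (L : ℝ) (p : Vec d), Continuous w →
      Tendsto (fun t => w (x t)) atTop (𝓝 L) → MapClusterPt p atTop x → w p = L := by
    intro w L p hw hL hp
    have h1 : MapClusterPt (w p) atTop (w ∘ x) := hp.continuousAt_comp hw.continuousAt
    have h2 : ClusterPt (w p) (𝓝 L) := ClusterPt.mono h1 hL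
    exact eq_of_nhds_neBot h2
  refine hKcomp.tendsto_nhds_of_unique_mapClusterPt (Eventually.of_forall hmem) ?_
  intro p hpK hp
  by_contra h
  have h1 := key v _ p hv hlim hp
  have h2 := key (fun y => v (f y)) _ p (hv.comp hf) hlim2 hp
  have h3 := hdec p ⟨hpK, h⟩
  linarith
end
end

section
/- Let L_v, L_f, L_π, β, τ ≥ 0 and set L_{Δv} = L_v·L_f·(L_π + 1) + L_v. Let f, μ : ℝ^{n_x} × ℝ^{n_u} → ℝ^{n_x} with f L_f-Lipschitz, let v : ℝ^{n_x} → ℝ be L_v-Lipschitz, let π : ℝ^{n_x} → ℝ^{n_u} be L_π-Lipschitz, and let σ : ℝ^{n_x} × ℝ^{n_u} → ℝ satisfy ‖f(x,u) − μ(x,u)‖₁ ≤ β·σ(x,u) for all (x,u). Then for all x, x' ∈ ℝ^{n_x} with ‖x − x'‖₁ ≤ τ, writing a = (x, π(x)) and a' = (x', π(x')), one has |v(μ(a')) − v(x') − (v(f(a)) − v(x))| ≤ L_v·β·σ(a') + L_{Δv}·τ. -/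
noncomputable section

/-- discretization error bound on the Lyapunov decrease
(Lemma 1 in the paper). All norms are ℓ¹ norms; on the product
`Vec nx × Vec nu` the ℓ¹ norm of `(x, u)` is `‖x‖ + ‖u‖`. -/
theorem lyapunov_decrease_confidence_bound
    (nx nu : ℕ) (Lv Lf Lπ β τ : ℝ)
    (hLv : 0 ≤ Lv) (hLf : 0 ≤ Lf) (hLπ : 0 ≤ Lπ) (hβ : 0 ≤ β) (hτ : 0 ≤ τ)
    (LΔv : ℝ) (hLΔv : LΔv = Lv * Lf * (Lπ + 1) + Lv)
    (f μ : Vec nx × Vec nu → Vec nx) (v : Vec nx → ℝ)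
    (π : Vec nx → Vec nu) (σ : Vec nx × Vec nu → ℝ)
    (hf : ∀ a b : Vec nx × Vec nu, ‖f a - f b‖ ≤ Lf * (‖a.1 - b.1‖ + ‖a.2 - b.2‖))
    (hv : ∀ x y : Vec nx, |v x - v y| ≤ Lv * ‖x - y‖)
    (hπ : ∀ x y : Vec nx, ‖π x - π y‖ ≤ Lπ * ‖x - y‖)
    (hσ : ∀ a : Vec nx × Vec nu, ‖f a - μ a‖ ≤ β * σ a)
    (x x' : Vec nx) (hxx' : ‖x - x'‖ ≤ τ) :
    |v (μ (x', π x')) - v x' - (v (f (x, π x)) - v x)|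
      ≤ Lv * β * σ (x', π x') + LΔv * τ := by
  have h1 := hv (f (x', π x')) (μ (x', π x'))
  have h2 := hv (f (x, π x)) (f (x', π x'))
  have h3 := hv x x'
  have h4 : Lv * ‖f (x', π x') - μ (x', π x')‖ ≤ Lv * (β * σ (x', π x')) :=
    mul_le_mul_of_nonneg_left (hσ _) hLv
  have h5 : ‖π x - π x'‖ ≤ Lπ * τ :=
    (hπ x x').trans (mul_le_mul_of_nonneg_left hxx' hLπ)
  have h6 : ‖f (x, π x) - f (x', π x')‖ ≤ Lf * (τ + Lπ * τ) :=
    (hf (x, π x) (x', π x')).trans (mul_le_mul_of_nonneg_left (add_le_add hxx' h5) hLf)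
  have h7 := mul_le_mul_of_nonneg_left h6 hLv
  have h8 := mul_le_mul_of_nonneg_left hxx' hLv
  have e : Lv * β * σ (x', π x') + LΔv * τ
      = Lv * (β * σ (x', π x')) + Lv * (Lf * (τ + Lπ * τ)) + Lv * τ := by
    rw [hLΔv]; ring
  rw [e]
  rw [abs_le] at h1 h2 h3 ⊢
  constructor <;> linarith [h1.1, h1.2, h2.1, h2.2, h3.1, h3.2]
end
end

section
/- Let L_v, L_f, L_π, τ ≥ 0 and set L_{Δv} = L_v·L_f·(L_π + 1) + L_v. Let f : ℝ^{n_x}×ℝ^{n_u} → ℝ^{n_x} be L_f-Lipschitz, let v : ℝ^{n_x} → ℝ be L_v-Lipschitz, let π : ℝ^{n_x} → ℝ^{n_u} be L_π-Lipschitz, and let u : ℝ^{n_x}×ℝ^{n_u} → ℝ satisfy v(f(x,w)) ≤ u(x,w) for all (x,w). Let c > 0, let V(c) = {x ∈ ℝ^{n_x} | v(x) ≤ c}, and let X_τ ⊆ ℝ^{n_x} be a set such that for every x ∈ V(c) \ {0} there exists x' ∈ X_τ ∩ (V(c) \ {0}) with ‖x − x'‖₁ ≤ τ. If u(x', π(x'))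 < v(x') − L_{Δv}·τ for every x' ∈ X_τ ∩ (V(c) \ {0}), then v(f(x, π(x))) < v(x) for every x ∈ V(c) \ {0}. -/
noncomputable section

/-- if the upper confidence bound `u` on `v ∘ f` satisfies the
strict decrease condition with margin `L_{Δv}·τ` on the discretization points
of the sublevel set `V(c)`, then the true Lyapunov decrease condition holds
on all of `V(c) \ {0}`. All norms are ℓ¹ norms. -/
theorem discrete_decrease_implies_continuous_decrease
    (nx nu : ℕ) (Lv Lf Lπ τ : ℝ)
    (hLv : 0 ≤ Lv) (hLf : 0 ≤ Lf) (hLπ : 0 ≤ Lπ) (hτ : 0 ≤ τ)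
    (LΔv : ℝ) (hLΔv : LΔv = Lv * Lf * (Lπ + 1) + Lv)
    (f : Vec nx × Vec nu → Vec nx) (v : Vec nx → ℝ)
    (π : Vec nx → Vec nu) (u : Vec nx × Vec nu → ℝ)
    (hf : ∀ a b : Vec nx × Vec nu, ‖f a - f b‖ ≤ Lf * (‖a.1 - b.1‖ + ‖a.2 - b.2‖))
    (hv : ∀ x y : Vec nx, |v x - v y| ≤ Lv * ‖x - y‖)
    (hπ : ∀ x y : Vec nx, ‖π x - π y‖ ≤ Lπ * ‖x - y‖)
    (hu : ∀ a : Vec nx × Vec nu, v (f a) ≤ u a)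
    (c : ℝ) (hc : 0 < c) (Xτ : Set (Vec nx))
    (hcover : ∀ x : Vec nx, v x ≤ c → x ≠ 0 →
      ∃ x' ∈ Xτ, v x' ≤ c ∧ x' ≠ 0 ∧ ‖x - x'‖ ≤ τ)
    (hdec : ∀ x' ∈ Xτ, v x' ≤ c → x' ≠ 0 → u (x', π x') < v x' - LΔv * τ) :
    ∀ x : Vec nx, v x ≤ c → x ≠ 0 → v (f (x, π x)) < v x := by
  intro x hx hx0
  obtain ⟨y, hyX, hyc, hy0, hd⟩ := hcover x hx hx0
  have h1 := hdec y hyX hyc hy0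
  have h2 := hu (y, π y)
  have h3 := (abs_le.mp (hv x y)).1
  have h4 := (abs_le.mp (hv (f (x, π x)) (f (y, π y)))).2
  have h5 : ‖f (x, π x) - f (y, π y)‖ ≤ Lf * (‖x - y‖ + ‖π x - π y‖) :=
    hf (x, π x) (y, π y)
  have h6 : ‖x - y‖ + ‖π x - π y‖ ≤ (Lπ + 1) * τ := by
    have := hπ x y
    have := mul_le_mul_of_nonneg_left hd hLπ
    linarith
  have h7 := mul_le_mul_of_nonneg_left (h5.trans (mul_le_mul_of_nonneg_left h6 hLf)) hLv
  have h8 := mul_le_mul_of_nonneg_left hd hLv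
  have h9 : LΔv * τ = Lv * (Lf * ((Lπ + 1) * τ)) + Lv * τ := by rw [hLΔv]; ring
  linarith
end
end

section
/- Fix finite sets X_τ ⊆ ℝ^{n_x} and U_τ ⊆ ℝ^{n_u}, a function v : ℝ^{n_x} → ℝ that is nonnegative and bounded above, and constants τ, L_{Δv}, L_v, L_f, L_π ≥ 0. For u : ℝ^{n_x}×ℝ^{n_u} → ℝ and S ⊆ X_τ×U_τ define D(u,S) = {a' ∈ X_τ×U_τ | ∃(x,w) ∈ S, u(x,w) − v(x) + L_{Δv}·‖a' − (x,w)‖₁ < −L_{Δv}·τ}, R^{level}(D) = ⋃ { {x ∈ ℝ^{n_x} | v(x) ≤ c} : c > 0, π : ℝ^{n_x} → ℝ^{n_u} is L_π-Lipschitz, and (x, π(x)) ∈ D for every x ∈ X_τ with v(x) ≤ c }, c(D) = sup{v(x) : x ∈ R^{level}(D)}, and S⁺(u,S) = {a' ∈ (R^{level}(D(u,S)) ∩ X_τ) × U_τ | ∃a ∈ S, u(a) + L_v·L_f·‖a − a'‖₁ ≤ c(D(u,S))}. Then for any u, u' with u'(a) ≤ u(a) for all a, and any S' ⊆ X_τ×U_τ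 satisfying S' ⊆ S⁺(u, S'), it holds that S⁺(u, S') ⊆ S⁺(u', S⁺(u, S')). In particular, the safe sets S_n generated by the algorithm with pointwise nonincreasing upper confidence bounds u_n form a nondecreasing sequence: S_{n−1} ⊆ S_n for all n ≥ 1. -/
noncomputable section

/-- The set `D(u, S)` of certified decrease pairs. ℓ¹ norms throughout. -/
def Dset (nx nu : ℕ) (Xτ : Finset (Vec nx)) (Uτ : Finset (Vec nu))
    (v : Vec nx → ℝ) (τ LΔv : ℝ) (u : Vec nx × Vec nu → ℝ)
    (S : Set (Vec nx × Vec nu)) : Set (Vec nx × Vec nu) :=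
  {a' | a'.1 ∈ Xτ ∧ a'.2 ∈ Uτ ∧ ∃ p ∈ S,
    u p - v p.1 + LΔv * (‖a'.1 - p.1‖ + ‖a'.2 - p.2‖) < -LΔv * τ}

/-- The operator `R^{level}(D)`. -/
def Rlevel (nx nu : ℕ) (Xτ : Finset (Vec nx)) (v : Vec nx → ℝ) (Lπ : ℝ)
    (D : Set (Vec nx × Vec nu)) : Set (Vec nx) :=
  ⋃ (c : ℝ) (_ : 0 < c) (π : Vec nx → Vec nu)
    (_ : ∀ x y : Vec nx, ‖π x - π y‖ ≤ Lπ * ‖x - y‖)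
    (_ : ∀ x ∈ Xτ, v x ≤ c → (x, π x) ∈ D),
    {x : Vec nx | v x ≤ c}

/-- The level `c(D)` of the estimated region of attraction. -/
def cD (nx nu : ℕ) (Xτ : Finset (Vec nx)) (v : Vec nx → ℝ) (Lπ : ℝ)
    (D : Set (Vec nx × Vec nu)) : ℝ :=
  sSup (v '' Rlevel nx nu Xτ v Lπ D)

/-- The safe set `S⁺(u, S)`: grid state-action pairs certified (via the upper
confidence bound `u` and Lipschitz generalization from `S`) to be mapped back
into the estimated region of attraction. -/
def Splus (nx nu : ℕ) (Xτ : Finset (Vec nx)) (Uτ : Finset (Vec nu))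
    (v : Vec nx → ℝ) (τ LΔv Lv Lf Lπ : ℝ) (u : Vec nx × Vec nu → ℝ)
    (S : Set (Vec nx × Vec nu)) : Set (Vec nx × Vec nu) :=
  {a' | a'.1 ∈ Rlevel nx nu Xτ v Lπ (Dset nx nu Xτ Uτ v τ LΔv u S) ∧
    a'.1 ∈ Xτ ∧ a'.2 ∈ Uτ ∧ ∃ a ∈ S,
      u a + Lv * Lf * (‖a.1 - a'.1‖ + ‖a.2 - a'.2‖)
        ≤ cD nx nu Xτ v Lπ (Dset nx nu Xτ Uτ v τ LΔv u S)}

theorem Rlevel_mono_aux (nx nu : ℕ) (Xτ : Finset (Vec nx)) (v : Vec nx → ℝ) (Lπ : ℝ)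
    {D D' : Set (Vec nx × Vec nu)} (h : D ⊆ D') :
    Rlevel nx nu Xτ v Lπ D ⊆ Rlevel nx nu Xτ v Lπ D' := by
  intro x hx
  simp only [Rlevel, Set.mem_iUnion] at hx ⊢
  obtain ⟨c, hc, p, hp, hD, hx⟩ := hx
  exact ⟨c, hc, p, hp, fun y hy hv => h (hD y hy hv), hx⟩

theorem Splus_mono_aux
    (nx nu : ℕ) (Xτ : Finset (Vec nx)) (Uτ : Finset (Vec nu))
    (v : Vec nx → ℝ) (hvbdd : BddAbove (Set.range v))
    (τ LΔv Lv Lf Lπ : ℝ) (u u' : Vec nx × Vec nu → ℝ) (hu : ∀ a, u' a ≤ u a)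
    (S S' : Set (Vec nx × Vec nu)) (hS : S ⊆ S') :
    Splus nx nu Xτ Uτ v τ LΔv Lv Lf Lπ u S ⊆ Splus nx nu Xτ Uτ v τ LΔv Lv Lf Lπ u' S' := by
  have hD : Dset nx nu Xτ Uτ v τ LΔv u S ⊆ Dset nx nu Xτ Uτ v τ LΔv u' S' := by
    rintro a ⟨h1, h2, p, hp, h⟩
    exact ⟨h1, h2, p, hS hp, by linarith [hu p]⟩
  have hR := Rlevel_mono_aux nx nu Xτ v Lπ hD
  rintro a ⟨h1, h2, h3, p, hp, h⟩
  refine ⟨hR h1, h2, h3, p, hS hp, ?_⟩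
  have hc : cD nx nu Xτ v Lπ (Dset nx nu Xτ Uτ v τ LΔv u S)
      ≤ cD nx nu Xτ v Lπ (Dset nx nu Xτ Uτ v τ LΔv u' S') :=
    csSup_le_csSup (hvbdd.mono (Set.image_subset_range _ _)) ⟨_, a.1, h1, rfl⟩
      (Set.image_mono hR)
  linarith [hu p]

/-- with pointwise nonincreasing upper confidence bounds, the
safe-set operator expands: if `S' ⊆ S⁺(u, S')` then
`S⁺(u, S') ⊆ S⁺(u', S⁺(u, S'))` for any `u' ≤ u`. In particular, the safe
sets `S n` generated by the algorithm form a nondecreasing sequence. -/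
theorem Splus_nondecreasing
    (nx nu : ℕ) (Xτ : Finset (Vec nx)) (Uτ : Finset (Vec nu))
    (v : Vec nx → ℝ) (hvnonneg : ∀ x, 0 ≤ v x) (hvbdd : BddAbove (Set.range v))
    (τ LΔv Lv Lf Lπ : ℝ) (hτ : 0 ≤ τ) (hLΔv : 0 ≤ LΔv)
    (hLv : 0 ≤ Lv) (hLf : 0 ≤ Lf) (hLπ : 0 ≤ Lπ) :
    (∀ u u' : Vec nx × Vec nu → ℝ, (∀ a, u' a ≤ u a) →
      ∀ S' : Set (Vec nx × Vec nu), S' ⊆ ↑(Xτ ×ˢ Uτ) →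
        S' ⊆ Splus nx nu Xτ Uτ v τ LΔv Lv Lf Lπ u S' →
        Splus nx nu Xτ Uτ v τ LΔv Lv Lf Lπ u S'
          ⊆ Splus nx nu Xτ Uτ v τ LΔv Lv Lf Lπ u'
              (Splus nx nu Xτ Uτ v τ LΔv Lv Lf Lπ u S')) ∧
    (∀ (u : ℕ → Vec nx × Vec nu → ℝ), (∀ n a, u (n + 1) a ≤ u n a) →
      ∀ (S : ℕ → Set (Vec nx × Vec nu)), S 0 ⊆ ↑(Xτ ×ˢ Uτ) →
        (∀ n : ℕ, S (n + 1) = Splus nx nu Xτ Uτ v τ LΔv Lv Lf Lπ (u (n + 1)) (S n)) →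
        S 0 ⊆ S 1 →
        ∀ n : ℕ, S n ⊆ S (n + 1)) := by
  refine ⟨fun u u' hu S' _ h => Splus_mono_aux nx nu Xτ Uτ v hvbdd τ LΔv Lv Lf Lπ u u' hu _ _ h, ?_⟩
  intro u hu S _ hS h0 n
  induction n with
  | zero => exact h0
  | succ n ih =>
    have h := Splus_mono_aux nx nu Xτ Uτ v hvbdd τ LΔv Lv Lf Lπ (u (n + 1)) (u (n + 1 + 1))
      (hu (n + 1)) _ _ ih
    rw [← hS n, ← hS (n + 1)] at h
    exact h
end
end

section
/- Let A be a type, B a finite set (Finset) in A, and S : ℕ → Finset A a monotone family (m ≤ n implies S(m) ⊆ S(n)) with S(0) nonempty and S(n) ⊆ B for all n. Let N : ℕ → ℕ be monotone with N(n) ≥ 1 for all n, and let n* ∈ ℕ satisfy n* ≥ |B| · N(n*). Then there exists n₀ ≤ n* such that S(n₀ + N(n₀)) = S(n₀). -/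
/-- a nondecreasing sequence of nonempty finite safe sets
contained in a finite set `B` must stop expanding within
`n* ≥ |B| · N(n*)` iterations: there is `n₀ ≤ n*` with
`S (n₀ + N n₀) = S n₀`. -/
theorem safe_set_stops_expanding {A : Type*} (B : Finset A) (S : ℕ → Finset A)
    (hmono : Monotone S) (h0 : (S 0).Nonempty) (hB : ∀ n : ℕ, S n ⊆ B)
    (N : ℕ → ℕ) (hNmono : Monotone N) (hN1 : ∀ n : ℕ, 1 ≤ N n)
    (nstar : ℕ) (hstar : B.card * N nstar ≤ nstar) :
    ∃ n0 ≤ nstar, S (n0 + N n0) = S n0 := by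
  by_contra! hcon
  have key : ∀ k : ℕ, k ≤ B.card → k + 1 ≤ (S (k * N nstar)).card := by
    intro k
    induction k with
    | zero =>
      intro _
      have := h0.card_pos
      simpa using this
    | succ k ih =>
      intro hk
      have h1 := ih (by omega)
      have h2 : k * N nstar ≤ nstar :=
        le_trans (Nat.mul_le_mul_right _ (by omega)) hstar
      have h3 : S (k * N nstar) ⊂ S (k * N nstar + N (k * N nstar)) :=
        lt_of_le_of_ne (hmono (Nat.le_add_right _ _)) (hcon _ h2).symm
      have h4 := Finset.card_lt_card h3
      have h5 : k * N nstar + N (k * N nstar) ≤ (k + 1) * N nstar := by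
        have := hNmono h2
        rw [Nat.succ_mul]
        omega
      have h6 := Finset.card_le_card (hmono h5)
      omega
  have h1 := key B.card le_rfl
  have h2 := Finset.card_le_card (hB (B.card * N nstar))
  omega
end

section
/- Let L_v, L_f, L_π, τ ≥ 0 and set L_{Δv} = L_v·L_f·(L_π + 1) + L_v. Let v : ℝ^{n_x} → ℝ be L_v-Lipschitz, f : ℝ^{n_x}×ℝ^{n_u} → ℝ^{n_x} be L_f-Lipschitz (ℓ¹ norms), and u : ℝ^{n_x}×ℝ^{n_u} → ℝ satisfy v(f(b)) ≤ u(b) for all b. Let a = (x, w) ∈ ℝ^{n_x}×ℝ^{n_u} and suppose there exists a' = (x', w') with u(a') − v(x') + L_{Δv}·‖a − a'‖₁ < −L_{Δv}·τ. Then v(f(a)) − v(x) < −L_{Δv}·τ; in particular v(f(x, w)) < v(x). Hence every state-action pair in the certified decrease set D(u, S) satisfies the strict Lyapunov decrease condition for the true dynamics. -/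
noncomputable section

/-- if a witness pair `a' = (x', w')` satisfies the certified
decrease condition `u a' − v x' + L_{Δv}·‖a − a'‖₁ < −L_{Δv}·τ`, where `u` is
an upper confidence bound on `v ∘ f`, then the true dynamics satisfy the
strict Lyapunov decrease condition at `a = (x, w)`:
`v (f a) − v x < −L_{Δv}·τ`, and in particular `v (f a) < v x`.
ℓ¹ norms throughout. -/
theorem certified_pair_satisfies_decrease
    (nx nu : ℕ) (Lv Lf Lπ τ : ℝ)
    (hLv : 0 ≤ Lv) (hLf : 0 ≤ Lf) (hLπ : 0 ≤ Lπ) (hτ : 0 ≤ τ)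
    (LΔv : ℝ) (hLΔv : LΔv = Lv * Lf * (Lπ + 1) + Lv)
    (v : Vec nx → ℝ) (f : Vec nx × Vec nu → Vec nx) (u : Vec nx × Vec nu → ℝ)
    (hv : ∀ x y : Vec nx, |v x - v y| ≤ Lv * ‖x - y‖)
    (hf : ∀ a b : Vec nx × Vec nu, ‖f a - f b‖ ≤ Lf * (‖a.1 - b.1‖ + ‖a.2 - b.2‖))
    (hu : ∀ b : Vec nx × Vec nu, v (f b) ≤ u b)
    (a a' : Vec nx × Vec nu)
    (h : u a' - v a'.1 + LΔv * (‖a.1 - a'.1‖ + ‖a.2 - a'.2‖) < -LΔv * τ) :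
    v (f a) - v a.1 < -LΔv * τ ∧ v (f a) < v a.1 := by
  have h1 := (abs_le.mp (hv (f a) (f a'))).2
  have h2 := (abs_le.mp (hv a.1 a'.1)).1
  have h3 := mul_le_mul_of_nonneg_left (hf a a') hLv
  have h4 := hu a'
  have n1 := norm_nonneg (a.1 - a'.1)
  have n2 := norm_nonneg (a.2 - a'.2)
  generalize ‖a.1 - a'.1‖ = p at *
  generalize ‖a.2 - a'.2‖ = q at *
  have h5 : 0 ≤ Lv * Lf * Lπ * (p + q) := by positivity
  have h6 : 0 ≤ Lv * q := by positivity
  have h7 : 0 ≤ LΔv * τ := by rw [hLΔv]; positivity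
  have h8 : LΔv * (p + q) = Lv * (Lf * (p + q)) + Lv * Lf * Lπ * (p + q) + Lv * p + Lv * q := by
    rw [hLΔv]; ring
  constructor <;> linarith
end
end
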